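/- There exist a real constant c > 0 and a natural s₀ such that for all naturals s ≥ s₀, setting n = s² and N = 2^s, the following holds for every string x : Fin n → Bool with (over ℝ) n/2 − s ≤ |x| ≤ n/2 + s: among all triples (T, C, κ) with T : Fin N → (Fin s → Fin n), C : Fin N → Fin N → (Fin s → Fin n), and κ : Fin N → Fin N → Fin n, the fraction of triples for which there exist indices i, j : Fin N and a coordinate k : Fin n with x k = false, κ i j = k, x satisfies T i, x^(k) does not satisfy T i' for every i' ≠ i, x^(k) falsifies C i j, and x does not falsify C i j' for every j' ≠ j, is at least c. -/

import Mathlib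

open scoped Classical

/-- `x` satisfies the term `T` if all variables of `T` are true in `x`. -/
def Satisfies {n s : ℕ} (x : Fin n → Bool) (T : Fin s → Fin n) : Prop :=
  ∀ m, x (T m) = true

/-- `x` falsifies the clause `Cl` if all variables of `Cl` are false in `x`. -/
def Falsifies {n s : ℕ} (x : Fin n → Bool) (Cl : Fin s → Fin n) : Prop :=
  ∀ m, x (Cl m) = false

/-- `x` with coordinate `k` flipped. -/
def flipCoord {n : ℕ} (x : Fin n → Bool) (k : Fin n) : Fin n → Bool :=
  Function.update x k (!x k)

/-- The number of true coordinates of `x`. -/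
def weight {n : ℕ} (x : Fin n → Bool) : ℕ :=
  (Finset.univ.filter fun k => x k = true).card

/-- The multiplexer map `Γ_{T,C}`; `Sum.inr false` is `0*`, `Sum.inr true` is `1*`. -/
noncomputable def Gamma {n s N : ℕ} (T : Fin N → Fin s → Fin n)
    (C : Fin N → Fin N → Fin s → Fin n) (x : Fin n → Bool) :
    (Fin N × Fin N) ⊕ Bool :=
  if h1 : ∃! i, Satisfies x (T i) then
    if h2 : ∃! j, Falsifies x (C (Classical.choose h1) j) then
      Sum.inl (Classical.choose h1, Classical.choose h2)
    else if ∃ j, Falsifies x (C (Classical.choose h1) j) then Sum.inr false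
    else Sum.inr true
  else if ∃ i, Satisfies x (T i) then Sum.inr true
  else Sum.inr false

/-- The function `f_{T,C,h}`. -/
noncomputable def fTCH {n s N : ℕ} (T : Fin N → Fin s → Fin n)
    (C : Fin N → Fin N → Fin s → Fin n)
    (h : Fin N → Fin N → (Fin n → Bool) → Bool) (x : Fin n → Bool) : Bool :=
  if ((n : ℝ) / 2 + s) < (weight x : ℝ) then true
  else if ((weight x : ℝ)) < ((n : ℝ) / 2 - s) then false
  else
    match Gamma T C x with
    | Sum.inl (i, j) => h i j x
    | Sum.inr b => b

/-! ### Counting -/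

theorem card_piFinset_ite {ι α : Type*} [Fintype ι] [DecidableEq ι] (i : ι) (A B : Finset α) :
    (Fintype.piFinset fun i' => if i' = i then A else B).card =
      A.card * B.card ^ (Fintype.card ι - 1) := by
  rw [Fintype.card_piFinset, ← Finset.mul_prod_erase _ _ (Finset.mem_univ i), if_pos rfl,
    Finset.prod_congr rfl (g := fun _ => B.card)
      (fun j hj => by rw [if_neg (Finset.ne_of_mem_erase hj)]),
    Finset.prod_const, Finset.card_erase_of_mem (Finset.mem_univ i), Finset.card_univ]

theorem card_filter_forall_eq {n s : ℕ} (x : Fin n → Bool) (b : Bool) :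
    (Finset.univ.filter fun t : Fin s → Fin n => ∀ m, x (t m) = b).card =
      (Finset.univ.filter fun k => x k = b).card ^ s := by
  have : (Finset.univ.filter fun t : Fin s → Fin n => ∀ m, x (t m) = b) =
      Fintype.piFinset fun _ => Finset.univ.filter fun k => x k = b := by
    ext t; simp
  rw [this, Fintype.card_piFinset]
  simp

theorem card_satisfies {n : ℕ} (s : ℕ) (x : Fin n → Bool) :
    (Finset.univ.filter fun t : Fin s → Fin n => Satisfies x t).card = weight x ^ s := by
  rw [weight, ← card_filter_forall_eq]
  congr!

theorem card_false {n : ℕ} (x : Fin n → Bool) :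
    (Finset.univ.filter fun k => x k = false).card = n - weight x := by
  have h := Finset.card_filter_add_card_filter_not (s := (Finset.univ : Finset (Fin n)))
    (fun k => x k = true)
  simp only [Bool.not_eq_true, Finset.card_univ, Fintype.card_fin] at h
  rw [weight]
  omega

theorem card_falsifies {n : ℕ} (s : ℕ) (x : Fin n → Bool) :
    (Finset.univ.filter fun t : Fin s → Fin n => Falsifies x t).card = (n - weight x) ^ s := by
  rw [← card_false, ← card_filter_forall_eq]
  congr!

theorem card_filter_not_fun {n s : ℕ} (p : (Fin s → Fin n) → Prop) :
    (Finset.univ.filter fun t => ¬ p t).card = n ^ s - (Finset.univ.filter fun t => p t).card := by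
  have h : (Finset.univ.filter fun t => p t).card + (Finset.univ.filter fun t => ¬ p t).card =
      n ^ s := by
    convert Finset.card_filter_add_card_filter_not (s := Finset.univ) p
    simp
  omega

theorem weight_flipCoord {n : ℕ} {x : Fin n → Bool} {k : Fin n} (hk : x k = false) :
    weight (flipCoord x k) = weight x + 1 := by
  have : (Finset.univ.filter fun l => flipCoord x k l = true) =
      insert k (Finset.univ.filter fun l => x l = true) := by
    ext l
    simp only [Finset.mem_filter, Finset.mem_insert, Finset.mem_univ, true_and]
    by_cases h : l = k
    · subst h; simp [flipCoord, hk]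
    · simp [flipCoord, h]
  rw [weight, this, Finset.card_insert_of_notMem (by simp [hk]), weight]

theorem Satisfies.flipCoord {n s : ℕ} {x : Fin n → Bool} {k : Fin n} {t : Fin s → Fin n}
    (h : Satisfies x t) (hk : x k = false) : Satisfies (flipCoord x k) t := by
  intro m
  have hm : t m ≠ k := fun e => by simpa [e, hk] using h m
  simpa [_root_.flipCoord, hm] using h m

theorem Falsifies.of_flipCoord {n s : ℕ} {x : Fin n → Bool} {k : Fin n} {t : Fin s → Fin n}
    (h : Falsifies (flipCoord x k) t) (hk : x k = false) : Falsifies x t := by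
  intro m
  have hm : t m ≠ k := fun e => by simpa [e, hk, flipCoord] using h m
  simpa [flipCoord, hm] using h m

/-- The triples `(T, C, κ)` for which the indices `i`, `j` and the coordinate `k` witness that `x`
is isolated. -/
noncomputable def isolating {n s N : ℕ} (x : Fin n → Bool) (i j : Fin N) (k : Fin n) :
    Finset ((Fin N → Fin s → Fin n) × (Fin N → Fin N → Fin s → Fin n) × (Fin N → Fin N → Fin n)) :=
  (Fintype.piFinset fun i' => if i' = i then Finset.univ.filter fun t => Satisfies x t
      else Finset.univ.filter fun t => ¬ Satisfies (flipCoord x k) t) ×ˢ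
  (Fintype.piFinset fun i' => if i' = i then
      Fintype.piFinset fun j' => if j' = j then
          Finset.univ.filter fun t => Falsifies (flipCoord x k) t
        else Finset.univ.filter fun t => ¬ Falsifies x t
      else Finset.univ) ×ˢ
  (Fintype.piFinset fun i' => if i' = i then
      Fintype.piFinset fun j' => if j' = j then {k} else Finset.univ
      else Finset.univ)

theorem forall_mem_ite {ι α : Type*} [DecidableEq ι] {i : ι} {A B : Finset α} {f : ι → α} :
    (∀ i', f i' ∈ if i' = i then A else B) ↔ f i ∈ A ∧ ∀ i', i' ≠ i → f i' ∈ B := by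
  refine ⟨fun h => ⟨by simpa using h i, fun i' hi => by simpa [hi] using h i'⟩, fun h i' => ?_⟩
  split_ifs with hi
  · exact hi ▸ h.1
  · exact h.2 i' hi

theorem mem_isolating {n s N : ℕ} {x : Fin n → Bool} {i j : Fin N} {k : Fin n}
    {T : Fin N → Fin s → Fin n} {C : Fin N → Fin N → Fin s → Fin n} {κ : Fin N → Fin N → Fin n} :
    (T, C, κ) ∈ isolating x i j k ↔
      (Satisfies x (T i) ∧ ∀ i', i' ≠ i → ¬ Satisfies (flipCoord x k) (T i')) ∧
      (Falsifies (flipCoord x k) (C i j) ∧ ∀ j', j' ≠ j → ¬ Falsifies x (C i j')) ∧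
      κ i j = k := by
  simp only [isolating, Finset.mem_product, Fintype.mem_piFinset, forall_mem_ite,
    Finset.mem_filter, Finset.mem_univ, true_and, Finset.mem_singleton, implies_true, and_true]

theorem card_isolating {n s N : ℕ} {x : Fin n → Bool} (i j : Fin N) {k : Fin n}
    (hk : x k = false) :
    (isolating (s := s) x i j k).card =
      (weight x ^ s * (n ^ s - (weight x + 1) ^ s) ^ (N - 1)) *
      (((n - (weight x + 1)) ^ s * (n ^ s - (n - weight x) ^ s) ^ (N - 1) *
          ((n ^ s) ^ N) ^ (N - 1)) *
        (n ^ (N - 1) * (n ^ N) ^ (N - 1))) := by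
  simp only [isolating, Finset.card_product, card_piFinset_ite, card_filter_not_fun,
    card_satisfies, card_falsifies, weight_flipCoord hk, Finset.card_univ, Fintype.card_fun,
    Fintype.card_fin, Finset.card_singleton, one_mul]

theorem isolating_index_eq {n s N : ℕ} {x : Fin n → Bool} {i j i' j' : Fin N} {k k' : Fin n}
    (hk : x k = false) (hk' : x k' = false)
    {τ : (Fin N → Fin s → Fin n) × (Fin N → Fin N → Fin s → Fin n) × (Fin N → Fin N → Fin n)}
    (h : τ ∈ isolating x i j k) (h' : τ ∈ isolating x i' j' k') :
    i = i' ∧ j = j' ∧ k = k' := by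
  obtain ⟨T, C, κ⟩ := τ
  rw [mem_isolating] at h h'
  have hi : i = i' := by
    by_contra hne
    exact h'.1.2 i hne (h.1.1.flipCoord hk')
  subst hi
  have hj : j = j' := by
    by_contra hne
    exact h'.2.1.2 j hne (h.2.1.1.of_flipCoord hk)
  subst hj
  exact ⟨rfl, rfl, h.2.2.symm.trans h'.2.2⟩

theorem card_biUnion_isolating {n s N : ℕ} (x : Fin n → Bool) :
    (((Finset.univ : Finset (Fin N)) ×ˢ (Finset.univ : Finset (Fin N)) ×ˢ
        Finset.univ.filter fun k => x k = false).biUnion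
        fun p => isolating (s := s) x p.1 p.2.1 p.2.2).card =
      N * (N * (n - weight x)) *
      ((weight x ^ s * (n ^ s - (weight x + 1) ^ s) ^ (N - 1)) *
      (((n - (weight x + 1)) ^ s * (n ^ s - (n - weight x) ^ s) ^ (N - 1) *
          ((n ^ s) ^ N) ^ (N - 1)) *
        (n ^ (N - 1) * (n ^ N) ^ (N - 1)))) := by
  rw [Finset.card_biUnion]
  · rw [Finset.sum_congr rfl fun p hp => card_isolating p.1 p.2.1 (by simpa using hp),
      Finset.sum_const, Finset.card_product, Finset.card_product, card_false, Finset.card_univ,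
      Fintype.card_fin, smul_eq_mul]
  · rintro ⟨i, j, k⟩ hp ⟨i', j', k'⟩ hp' hne
    refine Finset.disjoint_left.2 fun τ h h' => hne ?_
    obtain ⟨rfl, rfl, rfl⟩ := isolating_index_eq (by simpa using hp) (by simpa using hp') h h'
    rfl

/-! ### Estimates -/

theorem exp_neg_two_mul_le_one_sub {u : ℝ} (h0 : 0 ≤ u) (h1 : u ≤ 1 / 2) :
    Real.exp (-(2 * u)) ≤ 1 - u := by
  rw [Real.exp_neg, inv_le_iff_one_le_mul₀ (Real.exp_pos _)]
  nlinarith [Real.add_one_le_exp (2 * u)]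

theorem exp_neg_div_le_ratio_pow {s : ℕ} (hs : 8 ≤ s) {m : ℝ}
    (hm : (s : ℝ) ^ 2 / 2 - 2 * s ≤ m) :
    Real.exp (-8) / 2 ^ s ≤ (m / (s : ℝ) ^ 2) ^ s := by
  have hs' : (8 : ℝ) ≤ s := by exact_mod_cast hs
  have hpos : (0 : ℝ) < s := by linarith
  have h1 : Real.exp (-(2 * (4 / s))) / 2 ≤ m / (s : ℝ) ^ 2 := by
    have h := exp_neg_two_mul_le_one_sub (u := 4 / s) (by positivity)
      (by rw [div_le_div_iff₀ hpos two_pos]; linarith)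
    calc Real.exp (-(2 * (4 / s))) / 2 ≤ (1 - 4 / s) / 2 := by linarith
      _ = ((s : ℝ) ^ 2 / 2 - 2 * s) / s ^ 2 := by field_simp; ring
      _ ≤ m / (s : ℝ) ^ 2 := by gcongr
  calc Real.exp (-8) / 2 ^ s = (Real.exp (-(2 * (4 / s))) / 2) ^ s := by
        rw [div_pow, ← Real.exp_nat_mul]
        congr 2
        field_simp
        norm_num
    _ ≤ _ := by gcongr

theorem ratio_pow_le_exp_div {s : ℕ} (hs : 8 ≤ s) {m : ℝ} (h0 : 0 ≤ m)
    (hm : m ≤ (s : ℝ) ^ 2 / 2 + 2 * s) :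
    (m / (s : ℝ) ^ 2) ^ s ≤ Real.exp 4 / 2 ^ s := by
  have hs' : (8 : ℝ) ≤ s := by exact_mod_cast hs
  have hpos : (0 : ℝ) < s := by linarith
  have h1 : m / (s : ℝ) ^ 2 ≤ Real.exp (4 / (s : ℝ)) / 2 := by
    calc m / (s : ℝ) ^ 2 ≤ ((s : ℝ) ^ 2 / 2 + 2 * s) / (s : ℝ) ^ 2 := by gcongr
      _ = (4 / (s : ℝ) + 1) / 2 := by field_simp; ring
      _ ≤ _ := by linarith [Real.add_one_le_exp (4 / (s : ℝ))]
  calc (m / (s : ℝ) ^ 2) ^ s ≤ (Real.exp (4 / (s : ℝ)) / 2) ^ s := by gcongr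
    _ = _ := by
        rw [div_pow, ← Real.exp_nat_mul]
        congr 2
        field_simp

theorem exp_le_one_sub_ratio_pow {s : ℕ} (hs : 8 ≤ s) {m : ℝ} (h0 : 0 ≤ m)
    (hm : m ≤ (s : ℝ) ^ 2 / 2 + 2 * s) :
    Real.exp (-(2 * Real.exp 4)) ≤ (1 - (m / (s : ℝ) ^ 2) ^ s) ^ (2 ^ s - 1) := by
  have hN : (256 : ℝ) ≤ 2 ^ s := by
    calc (256 : ℝ) = 2 ^ 8 := by norm_num
      _ ≤ 2 ^ s := by gcongr; norm_num
  have he : Real.exp 4 ≤ 81 := by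
    calc Real.exp 4 = Real.exp 1 ^ 4 := by rw [← Real.exp_nat_mul]; norm_num
      _ ≤ 3 ^ 4 := by gcongr; exact Real.exp_one_lt_three.le
      _ = 81 := by norm_num
  have hu : Real.exp 4 / 2 ^ s ≤ 1 / 2 := by
    rw [div_le_div_iff₀ (by positivity) two_pos]; linarith
  have h := exp_neg_two_mul_le_one_sub (u := Real.exp 4 / 2 ^ s) (by positivity) hu
  have h' := ratio_pow_le_exp_div hs h0 hm
  calc Real.exp (-(2 * Real.exp 4)) = Real.exp (-(2 * (Real.exp 4 / 2 ^ s))) ^ 2 ^ s := by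
        rw [← Real.exp_nat_mul]
        congr 1
        push_cast
        field_simp
    _ ≤ Real.exp (-(2 * (Real.exp 4 / 2 ^ s))) ^ (2 ^ s - 1) :=
        pow_le_pow_of_le_one (Real.exp_pos _).le (Real.exp_le_one_iff.2 (by simp; positivity))
          (Nat.sub_le _ _)
    _ ≤ _ := by gcongr; linarith

theorem count_div_total {N n : ℝ} {e M : ℕ} (hn : n ≠ 0) (w z u v y : ℝ) :
    N * (N * z) * ((w ^ e * (n ^ e - u ^ e) ^ M) *
      ((y ^ e * (n ^ e - v ^ e) ^ M * ((n ^ e) ^ (M + 1)) ^ M) *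
        (n ^ M * (n ^ (M + 1)) ^ M))) /
      (n ^ (e * (M + 1)) * n ^ (e * (M + 1) * (M + 1)) * n ^ ((M + 1) * (M + 1))) =
    z / n * (N * (w / n) ^ e) * (N * (y / n) ^ e) * (1 - (u / n) ^ e) ^ M *
      (1 - (v / n) ^ e) ^ M := by
  have h (t : ℝ) : n ^ e - t ^ e = n ^ e * (1 - (t / n) ^ e) := by
    rw [div_pow]; field_simp
  rw [h u, h v, mul_pow, mul_pow, div_pow w, div_pow y, div_eq_iff (by positivity)]
  generalize 1 - (u / n) ^ e = a
  generalize 1 - (v / n) ^ e = b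
  field_simp
  ring

/-- for every middle-layer string `x`, an `Ω(1)` fraction of the
triples `(T, C, κ)` put `x` into the set `X'` of the no-case analysis. -/
theorem statement10 : ∃ c : ℝ, 0 < c ∧ ∃ s₀ : ℕ, ∀ s : ℕ, s₀ ≤ s →
    ∀ x : Fin (s ^ 2) → Bool,
      ((s : ℝ) ^ 2 / 2 - s ≤ (weight x : ℝ)) →
      ((weight x : ℝ) ≤ (s : ℝ) ^ 2 / 2 + s) →
      c ≤ (((Finset.univ.filter fun TCκ :
              (Fin (2 ^ s) → Fin s → Fin (s ^ 2)) ×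
              (Fin (2 ^ s) → Fin (2 ^ s) → Fin s → Fin (s ^ 2)) ×
              (Fin (2 ^ s) → Fin (2 ^ s) → Fin (s ^ 2)) =>
            ∃ i j : Fin (2 ^ s), ∃ k : Fin (s ^ 2),
              x k = false ∧ TCκ.2.2 i j = k ∧
              Satisfies x (TCκ.1 i) ∧
              (∀ i' : Fin (2 ^ s), i' ≠ i →
                ¬ Satisfies (flipCoord x k) (TCκ.1 i')) ∧
              Falsifies (flipCoord x k) (TCκ.2.1 i j) ∧
              (∀ j' : Fin (2 ^ s), j' ≠ j →
                ¬ Falsifies x (TCκ.2.1 i j'))).card : ℝ) /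
          (((s : ℝ) ^ 2) ^ (s * 2 ^ s) * ((s : ℝ) ^ 2) ^ (s * 2 ^ s * 2 ^ s) *
            ((s : ℝ) ^ 2) ^ (2 ^ s * 2 ^ s))) := by
  refine ⟨1 / 4 * Real.exp (-8) * Real.exp (-8) * Real.exp (-(2 * Real.exp 4)) *
    Real.exp (-(2 * Real.exp 4)), by positivity, 8, fun s hs x hlo hhi => ?_⟩
  have hs' : (8 : ℝ) ≤ s := by exact_mod_cast hs
  have hsq : (8 : ℝ) * s ≤ (s : ℝ) ^ 2 := by nlinarith
  set w := weight x with hw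
  have hw1 : w + 1 ≤ s ^ 2 := by
    have : (w : ℝ) + 1 ≤ (s : ℝ) ^ 2 := by linarith
    exact_mod_cast this
  have hwpow : (w + 1) ^ s ≤ (s ^ 2) ^ s := by gcongr
  have hzpow : (s ^ 2 - w) ^ s ≤ (s ^ 2) ^ s := by gcongr; exact Nat.sub_le _ _
  have hcard := card_biUnion_isolating (s := s) (N := 2 ^ s) x
  rw [← hw] at hcard
  have hN : 2 ^ s - 1 + 1 = 2 ^ s := Nat.sub_add_cancel Nat.one_le_two_pow
  have hratio := count_div_total (N := 2 ^ s) (n := (s : ℝ) ^ 2) (e := s) (M := 2 ^ s - 1)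
    (by positivity) w ((s : ℝ) ^ 2 - w) (w + 1) ((s : ℝ) ^ 2 - w) ((s : ℝ) ^ 2 - (w + 1))
  rw [hN] at hratio
  refine le_trans ?_ (div_le_div_of_nonneg_right (Nat.cast_le.2 (Finset.card_le_card
    (s := (Finset.univ ×ˢ Finset.univ ×ˢ Finset.univ.filter fun k => x k = false).biUnion
        fun p => isolating (s := s) (N := 2 ^ s) x p.1 p.2.1 p.2.2) ?_)) (by positivity))
  · rw [hcard]
    push_cast [Nat.cast_sub hw1, Nat.cast_sub (show w ≤ s ^ 2 by omega), Nat.cast_sub hwpow,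
      Nat.cast_sub hzpow]
    rw [hratio]
    have lower {m : ℝ} (hm : (s : ℝ) ^ 2 / 2 - 2 * s ≤ m) :
        Real.exp (-8) ≤ 2 ^ s * (m / (s : ℝ) ^ 2) ^ s := by
      have := exp_neg_div_le_ratio_pow hs hm
      rwa [div_le_iff₀' (by positivity)] at this
    have h1 : 1 / 4 ≤ ((s : ℝ) ^ 2 - w) / (s : ℝ) ^ 2 := by
      rw [div_le_div_iff₀ (by norm_num) (by positivity)]; linarith
    have h2 := lower (m := w) (by linarith)
    have h3 := lower (m := (s : ℝ) ^ 2 - (w + 1)) (by linarith)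
    have h4 := exp_le_one_sub_ratio_pow (m := w + 1) hs (by positivity) (by linarith)
    have h5 := exp_le_one_sub_ratio_pow (m := (s : ℝ) ^ 2 - w) hs (by linarith) (by linarith)
    exact mul_le_mul_of_nonneg (mul_le_mul_of_nonneg (mul_le_mul_of_nonneg
      (mul_le_mul_of_nonneg h1 h2 (by positivity) ((Real.exp_pos _).le.trans h2))
      h3 (by positivity) ((Real.exp_pos _).le.trans h3))
      h4 (by positivity) ((Real.exp_pos _).le.trans h4))
      h5 (by positivity) ((Real.exp_pos _).le.trans h5)
  · rintro ⟨T, C, κ⟩ h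
    simp only [Finset.mem_biUnion, Finset.mem_product, Finset.mem_filter, Finset.mem_univ,
      true_and, Prod.exists, mem_isolating] at h
    obtain ⟨i, j, k, hk, ⟨h1, h2⟩, ⟨h3, h4⟩, h5⟩ := h
    exact Finset.mem_filter.2 ⟨Finset.mem_univ _, i, j, k, hk, h5, h1, h2, h3, h4⟩
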